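/- Let X_1,…,X_n be i.i.d. from a density f ∈ F_d and let f̂_n be the sinc kernel estimator with bandwidth h > 0. Then E_f ∫ (f̂_n(x) − f(x))² dx ≤ π^{−d}/(n h^d) + d·2^{1−d}·π^{−d/2}·exp(−1/h²). In particular, taking h = (log n)^{−1/2} yields sup_{f ∈ F_d} E_f L²(f̂_n, f) ≤ C_d (log n)^{d/2}/n for a constant C_d depending only on d. -/

import Mathlib

open MeasureTheory Real ENNReal

noncomputable def gauss (x : ℝ) : ℝ := Real.exp (-(x^2)/2) / Real.sqrt (2*Real.pi)

noncomputable def mixDensity (d : ℕ) (G : Measure (Fin d → ℝ)) : (Fin d → ℝ) → ℝ :=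
  fun x => ∫ u, ∏ i, gauss (x i - u i) ∂G

def gaussMixtures (d : ℕ) : Set ((Fin d → ℝ) → ℝ) :=
  {f | ∃ G : Measure (Fin d → ℝ), IsProbabilityMeasure G ∧ f = mixDensity d G}

/-- The sinc kernel `K(y) = sin y / (π y)` (with its continuous value `1/π` at `0`). -/
noncomputable def sincK (y : ℝ) : ℝ :=
  if y = 0 then 1 / Real.pi else Real.sin y / (Real.pi * y)

/-- The sinc kernel density estimator with bandwidth `h` based on samples `X 0, …, X (n-1)`. -/
noncomputable def sincEst (d n : ℕ) (h : ℝ) (X : Fin n → Fin d → ℝ)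
    (x : Fin d → ℝ) : ℝ :=
  (1 / (n * h^d)) * ∑ i : Fin n, ∏ j : Fin d, sincK ((X i j - x j) / h)

noncomputable def jointMeasure (d n : ℕ) (f : (Fin d → ℝ) → ℝ) :
    Measure (Fin n → Fin d → ℝ) :=
  volume.withDensity (fun X => ∏ i, ENNReal.ofReal (f (X i)))

/-- The L² risk `E_f ∫ (f̂_n(x) - f(x))² dx` of the sinc kernel estimator. -/
noncomputable def sincRisk (d n : ℕ) (f : (Fin d → ℝ) → ℝ) (h : ℝ) : ℝ≥0∞ :=
  ∫⁻ X, (∫⁻ x, ENNReal.ofReal ((sincEst d n h X x - f x)^2)) ∂(jointMeasure d n f)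

open scoped FourierTransform Convolution

lemma sincK_eq (y : ℝ) : sincK y = Real.sinc y / Real.pi := by
  unfold sincK
  split_ifs with h
  · simp [h]
  · rw [Real.sinc_of_ne_zero h]; field_simp

lemma sinc_rep (c s : ℝ) :
    ∫ t in -c..c, Complex.exp ((t * s : ℝ) * Complex.I) = 2 * c * Real.sinc (c * s) := by
  by_cases hs : s = 0
  · subst hs
    simp; ring
  · have h := intervalIntegral.integral_comp_mul_right (a := -c) (b := c)
      (fun t : ℝ => Complex.exp ((t : ℝ) * Complex.I)) hs
    rw [h, neg_mul, integral_exp_mul_I_eq_sinc]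
    rw [Complex.real_smul]
    push_cast
    have : (s : ℂ) ≠ 0 := by exact_mod_cast hs
    field_simp

/-- modulated box function -/
noncomputable def boxF (a : ℝ) : ℝ → ℂ :=
  Set.indicator (Set.Ioc (-(1/(2*Real.pi))) (1/(2*Real.pi)))
    (fun t => Complex.exp ((t * (2*Real.pi*a) : ℝ) * Complex.I))

lemma boxF_integrable (a : ℝ) : Integrable (boxF a) := by
  unfold boxF
  rw [integrable_indicator_iff measurableSet_Ioc]
  apply Continuous.integrableOn_Ioc
  fun_prop

lemma boxF_norm_le (a t : ℝ) : ‖boxF a t‖ ≤ 1 := by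
  unfold boxF
  refine (norm_indicator_le_norm_self _ _).trans ?_
  rw [Complex.norm_exp_ofReal_mul_I]

lemma box_int (s : ℝ) :
    ∫ t in Set.Ioc (-(1/(2*Real.pi))) (1/(2*Real.pi)),
      Complex.exp ((t * (2*Real.pi*s) : ℝ) * Complex.I) = sincK s := by
  have hp := Real.pi_pos
  have h := sinc_rep (1/(2*Real.pi)) (2*Real.pi*s)
  rw [intervalIntegral.integral_of_le (by
    have : 0 < 1/(2*Real.pi) := by positivity
    linarith)] at h
  rw [h, sincK_eq]
  have h2 : (1/(2*Real.pi)) * (2*Real.pi*s) = s := by field_simp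
  rw [h2]
  have : (Real.pi : ℂ) ≠ 0 := by exact_mod_cast hp.ne'
  push_cast
  field_simp

lemma boxF_fourier (a y : ℝ) : 𝓕 (boxF a) y = sincK (a - y) := by
  rw [Real.fourier_real_eq_integral_exp_smul, ← box_int, ← integral_indicator measurableSet_Ioc]
  congr 1
  ext t
  unfold boxF
  by_cases ht : t ∈ Set.Ioc (-(1/(2*Real.pi))) (1/(2*Real.pi))
  · rw [Set.indicator_of_mem ht, Set.indicator_of_mem ht, smul_eq_mul, ← Complex.exp_add]
    congr 1
    push_cast
    ring
  · rw [Set.indicator_of_notMem ht, Set.indicator_of_notMem ht, smul_zero]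

lemma boxF_contAt (b t : ℝ) (h1 : t ≠ -(1/(2*Real.pi))) (h2 : t ≠ (1/(2*Real.pi))) :
    ContinuousAt (boxF b) t := by
  unfold boxF
  have hc : Continuous (fun t : ℝ => Complex.exp ((t * (2*Real.pi*b) : ℝ) * Complex.I)) := by
    fun_prop
  refine hc.continuousOn.continuousAt_indicator ?_
  have : 0 < 1/(2*Real.pi) := by positivity
  rw [frontier_Ioc (by linarith)]
  simp only [Set.mem_insert_iff, Set.mem_singleton_iff, not_or]
  exact ⟨h1, h2⟩

lemma sincK_cont : Continuous sincK := by
  have : sincK = fun y => Real.sinc y / Real.pi := funext sincK_eq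
  rw [this]
  exact Real.continuous_sinc.div_const _

lemma sincK_abs_le (y : ℝ) : |sincK y| ≤ 1 / Real.pi := by
  rw [sincK_eq, abs_div, abs_of_pos Real.pi_pos]
  gcongr
  exact Real.abs_sinc_le_one y

lemma sincK_sq_le (y : ℝ) : sincK y ^ 2 ≤ 2 * (1 + y^2)⁻¹ := by
  have hp := Real.pi_gt_three
  have h1 : Real.sinc y ^ 2 * (1 + y^2) ≤ 2 := by
    by_cases hy : y = 0
    · subst hy; simp
    · have hb : Real.sinc y ^ 2 ≤ 1 := by
        rw [sq_le_one_iff_abs_le_one]; exact Real.abs_sinc_le_one y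
      have hc : Real.sinc y ^ 2 * y ^ 2 ≤ 1 := by
        rw [Real.sinc_of_ne_zero hy]
        have : (Real.sin y / y)^2 * y^2 = Real.sin y ^ 2 := by field_simp
        rw [this]
        exact Real.sin_sq_le_one y
      linarith
  rw [sincK_eq, div_pow, ← div_eq_mul_inv, div_le_div_iff₀ (by positivity) (by positivity)]
  nlinarith [sq_nonneg (Real.sinc y)]

lemma sincK_memLp (a : ℝ) : MemLp (fun y => sincK (a - y)) 2 := by
  have hc : Continuous (fun y => sincK (a - y)) := sincK_cont.comp (by fun_prop)
  rw [memLp_two_iff_integrable_sq hc.aestronglyMeasurable]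
  have h : Integrable (fun y : ℝ => 2 * (1 + (a - y)^2)⁻¹) :=
    (integrable_inv_one_add_sq.comp_sub_left a).const_mul 2
  refine h.mono' (hc.pow 2).aestronglyMeasurable ?_
  filter_upwards with y
  rw [Real.norm_of_nonneg (sq_nonneg _)]
  exact sincK_sq_le _

lemma sincK_mul_integrable (a b : ℝ) : Integrable (fun y => sincK (a - y) * sincK (b - y)) :=
  (sincK_memLp a).integrable_mul (sincK_memLp b)

lemma sincK_repro (a b : ℝ) : ∫ y, sincK (a - y) * sincK (b - y) = sincK (a - b) := by
  set φ : ℝ → ℂ := (boxF a) ⋆[ContinuousLinearMap.mul ℂ ℂ] (boxF b) with hφ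
  have hint : Integrable φ := (boxF_integrable a).integrable_convolution _ (boxF_integrable b)
  have hF : 𝓕 φ = fun y => ((sincK (a - y) * sincK (b - y) : ℝ) : ℂ) := by
    ext y
    rw [hφ, Real.fourier_mul_convolution_eq (boxF_integrable a) (boxF_integrable b),
      boxF_fourier, boxF_fourier]
    push_cast; rfl
  have hFi : Integrable (𝓕 φ) := by
    rw [hF]; exact (sincK_mul_integrable a b).ofReal
  have hc : ContinuousAt φ 0 := by
    have : φ = fun x => ∫ t, boxF a t * boxF b (x - t) := by
      ext x; rfl
    rw [this]
    refine continuousAt_of_dominated (bound := fun t => ‖boxF a t‖) ?_ ?_ ?_ ?_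
    · filter_upwards with x
      exact (boxF_integrable a).aestronglyMeasurable.mul
        ((boxF_integrable b).comp_sub_left x).aestronglyMeasurable
    · filter_upwards with x
      filter_upwards with t
      rw [norm_mul]
      exact mul_le_of_le_one_right (norm_nonneg _) (boxF_norm_le _ _)
    · exact (boxF_integrable a).norm
    · have : ({-(1/(2*Real.pi)), (1/(2*Real.pi))} : Set ℝ)ᶜ ∈ ae (volume : Measure ℝ) := by
        rw [compl_mem_ae_iff]
        exact (Set.toFinite _).measure_zero _
      filter_upwards [this] with t ht
      simp only [Set.mem_compl_iff, Set.mem_insert_iff, Set.mem_singleton_iff, not_or] at ht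
      apply ContinuousAt.mul continuousAt_const
      apply ContinuousAt.comp (f := fun x : ℝ => x - t) (g := boxF b)
      · apply boxF_contAt
        · intro h; apply ht.2; linarith
        · intro h; apply ht.1; linarith
      · fun_prop
  have hinv := hint.fourierInv_fourier_eq hFi hc
  rw [hF, Real.fourierInv_eq'] at hinv
  have h0 : φ 0 = sincK (a - b) := by
    rw [← box_int, ← integral_indicator measurableSet_Ioc]
    have : φ 0 = ∫ t, boxF a t * boxF b (0 - t) := rfl
    rw [this]
    apply integral_congr_ae
    have : ({-(1/(2*Real.pi)), (1/(2*Real.pi))} : Set ℝ)ᶜ ∈ ae (volume : Measure ℝ) := by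
      rw [compl_mem_ae_iff]
      exact (Set.toFinite _).measure_zero _
    filter_upwards [this] with t ht
    simp only [Set.mem_compl_iff, Set.mem_insert_iff, Set.mem_singleton_iff, not_or] at ht
    unfold boxF
    by_cases hm : t ∈ Set.Ioc (-(1/(2*Real.pi))) (1/(2*Real.pi))
    · have hm' : 0 - t ∈ Set.Ioc (-(1/(2*Real.pi))) (1/(2*Real.pi)) := by
        have := lt_of_le_of_ne hm.2 ht.2
        exact ⟨by linarith, by linarith [hm.1]⟩
      rw [Set.indicator_of_mem hm, Set.indicator_of_mem hm, Set.indicator_of_mem hm',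
        ← Complex.exp_add]
      congr 1
      push_cast
      ring
    · rw [Set.indicator_of_notMem hm, Set.indicator_of_notMem hm, zero_mul]
  rw [h0] at hinv
  simp only [inner_zero_right, mul_zero, Complex.ofReal_zero, zero_mul, Complex.exp_zero,
    one_smul] at hinv
  rw [integral_complex_ofReal] at hinv
  exact_mod_cast hinv

/-- scaled sinc kernel -/
noncomputable def kap (h s : ℝ) : ℝ := h⁻¹ * sincK (s / h)

lemma kap_cont (h : ℝ) : Continuous (kap h) := by
  unfold kap
  exact continuous_const.mul (sincK_cont.comp (by fun_prop))

lemma kap_neg (h s : ℝ) : kap h (-s) = kap h s := by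
  unfold kap
  rw [sincK_eq, sincK_eq, neg_div, Real.sinc_neg]

lemma kap_zero (h : ℝ) : kap h 0 = h⁻¹ * (1 / Real.pi) := by
  simp [kap, sincK]

lemma kap_abs_le {h : ℝ} (hh : 0 < h) (s : ℝ) : |kap h s| ≤ h⁻¹ * (1 / Real.pi) := by
  unfold kap
  rw [abs_mul, abs_of_pos (inv_pos.2 hh)]
  gcongr
  exact sincK_abs_le _

lemma kap_memLp {h : ℝ} (hh : 0 < h) (a : ℝ) : MemLp (fun y => kap h (a - y)) 2 := by
  have hc : Continuous (fun y => kap h (a - y)) := (kap_cont h).comp (by fun_prop)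
  rw [memLp_two_iff_integrable_sq hc.aestronglyMeasurable]
  have h1 := ((sincK_memLp (a / h)).integrable_sq.comp_div hh.ne').const_mul (h⁻¹ ^ 2)
  refine h1.congr (ae_of_all _ fun y => ?_)
  simp only [kap]
  rw [mul_pow, sub_div]

lemma kap_repro {h : ℝ} (hh : 0 < h) (a b : ℝ) :
    ∫ y, kap h (a - y) * kap h (b - y) = kap h (a - b) := by
  have h1 := Measure.integral_comp_div (fun y => sincK (a / h - y) * sincK (b / h - y)) h
  rw [sincK_repro, smul_eq_mul, abs_of_pos hh] at h1
  have : ∀ y, kap h (a - y) * kap h (b - y)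
      = h⁻¹ ^ 2 * (sincK (a / h - y / h) * sincK (b / h - y / h)) := by
    intro y
    simp only [kap, sub_div]
    ring
  simp_rw [this]
  rw [integral_const_mul, h1]
  unfold kap
  rw [sub_div]
  field_simp

lemma kap_rep {h : ℝ} (hh : 0 < h) (s : ℝ) :
    (kap h s : ℂ) = (1 / (2 * Real.pi) : ℝ) *
      ∫ t in Set.Ioc (-h⁻¹) h⁻¹, Complex.exp ((t * s : ℝ) * Complex.I) := by
  have h0 : 0 < h⁻¹ := inv_pos.2 hh
  rw [← intervalIntegral.integral_of_le (by linarith), sinc_rep]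
  unfold kap
  rw [sincK_eq]
  have : (Real.pi : ℂ) ≠ 0 := by exact_mod_cast Real.pi_ne_zero
  rw [div_eq_inv_mul s h]
  push_cast
  field_simp

lemma gauss_eq (x u : ℝ) : gauss (x - u) = ProbabilityTheory.gaussianPDFReal u 1 x := by
  unfold gauss ProbabilityTheory.gaussianPDFReal
  simp
  rw [div_eq_inv_mul]
  ring_nf

lemma gauss_cont : Continuous gauss := by
  unfold gauss
  fun_prop

lemma gauss_nonneg (x : ℝ) : 0 ≤ gauss x := by
  unfold gauss; positivity

lemma gauss_le_one (x : ℝ) : gauss x ≤ 1 := by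
  unfold gauss
  have h1 : 1 ≤ Real.sqrt (2 * Real.pi) := by
    rw [Real.one_le_sqrt]; linarith [Real.pi_gt_three]
  rw [div_le_one (by linarith)]
  refine le_trans ?_ h1
  rw [Real.exp_le_one_iff]
  nlinarith [sq_nonneg x]

lemma gauss_integrable (u : ℝ) : Integrable (fun x => gauss (x - u)) := by
  simp_rw [gauss_eq]
  exact ProbabilityTheory.integrable_gaussianPDFReal u 1

lemma gauss_integral (u : ℝ) : ∫ x, gauss (x - u) = 1 := by
  simp_rw [gauss_eq]
  exact ProbabilityTheory.integral_gaussianPDFReal_eq_one u one_ne_zero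

/-- the one-dimensional pairing of Gaussians -/
noncomputable def pairA (u v : ℝ) : ℝ := ∫ x, gauss (x - u) * gauss (x - v)

/-- the one-dimensional pairing of Gaussians through the sinc kernel -/
noncomputable def pairB (h u v : ℝ) : ℝ :=
  ∫ b, (∫ a, kap h (a - b) * gauss (a - u)) * gauss (b - v)

lemma pairA_eq (u v : ℝ) :
    (pairA u v : ℂ) = (1 / (2 * Real.pi) : ℝ) *
      ∫ t : ℝ, Complex.exp ((t * (u - v) : ℝ) * Complex.I) * Real.exp (-t^2) := by
  have h1 := fourierIntegral_gaussian (b := 1) (by simp) ((u - v : ℝ) : ℂ)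
  have h2 : ∫ t : ℝ, Complex.exp ((t * (u - v) : ℝ) * Complex.I) * Real.exp (-t^2)
      = ∫ x : ℝ, Complex.exp (Complex.I * ((u - v : ℝ) : ℂ) * x) * Complex.exp (-1 * x ^ 2) := by
    congr 1
    ext t
    push_cast
    congr 2 <;> ring
  rw [h2, h1]
  have h3 : pairA u v = 1 / (2 * Real.pi) * (Real.sqrt Real.pi * Real.exp (-(u - v)^2/4)) := by
    unfold pairA
    have : ∀ x, gauss (x - u) * gauss (x - v) = (1 / (2 * Real.pi) * Real.exp (-(u - v)^2/4)) *
        Real.exp (-1 * (x - (u + v)/2)^2) := by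
      intro x
      unfold gauss
      rw [div_mul_div_comm, Real.mul_self_sqrt (by positivity), ← Real.exp_add, mul_assoc,
        ← Real.exp_add, div_eq_inv_mul, one_div]
      congr 2
      ring
    simp_rw [this]
    rw [integral_const_mul, integral_sub_right_eq_self (fun x => Real.exp (-1 * x^2)),
      integral_gaussian]
    simp only [div_one]
    ring
  rw [h3]
  have h4 : ((Real.pi : ℂ) / 1) ^ (1 / 2 : ℂ) = (Real.sqrt Real.pi : ℝ) := by
    rw [Real.sqrt_eq_rpow, Complex.ofReal_cpow Real.pi_pos.le]
    simp
  rw [h4]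
  push_cast
  simp

lemma pairB_eq {h : ℝ} (hh : 0 < h) (u v : ℝ) :
    (pairB h u v : ℂ) = (1 / (2 * Real.pi) : ℝ) *
      ∫ t : ℝ in Set.Ioc (-h⁻¹) h⁻¹,
        Complex.exp ((t * (u - v) : ℝ) * Complex.I) * Real.exp (-t^2) := by
  set N : ℝ → Measure ℝ := fun u => ProbabilityTheory.gaussianReal u 1
  have hb : pairB h u v = ∫ b, ∫ a, kap h (a - b) ∂(N u) ∂(N v) := by
    unfold pairB
    simp only [N]
    simp_rw [ProbabilityTheory.integral_gaussianReal_eq_integral_smul (one_ne_zero), ← gauss_eq,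
      smul_eq_mul, mul_comm]
  have hkb : Integrable (fun p : ℝ × ℝ => kap h (p.2 - p.1)) ((N v).prod (N u)) := by
    have hc : Continuous (fun p : ℝ × ℝ => kap h (p.2 - p.1)) := (kap_cont h).comp (by fun_prop)
    refine Integrable.of_bound hc.aestronglyMeasurable (h⁻¹ * (1 / Real.pi)) ?_
    filter_upwards with p
    exact kap_abs_le hh _
  rw [hb, ← integral_prod _ hkb, ← integral_complex_ofReal]
  simp_rw [kap_rep hh]
  rw [integral_const_mul]
  congr 1
  rw [integral_integral_swap]
  · congr 1
    ext t
    have : ∀ p : ℝ × ℝ, Complex.exp ((t * (p.2 - p.1) : ℝ) * Complex.I)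
        = Complex.exp (((-t : ℝ) : ℂ) * p.1 * Complex.I) * Complex.exp (t * p.2 * Complex.I) := by
      intro p
      rw [← Complex.exp_add]
      congr 1
      push_cast
      ring
    simp_rw [this]
    rw [integral_prod_mul (fun x : ℝ => Complex.exp (((-t : ℝ) : ℂ) * x * Complex.I))
      (fun x : ℝ => Complex.exp (t * x * Complex.I)), ← charFun_apply_real, ← charFun_apply_real]
    simp only [N]
    rw [ProbabilityTheory.charFun_gaussianReal, ProbabilityTheory.charFun_gaussianReal,
      ← Complex.exp_add, Complex.ofReal_exp, ← Complex.exp_add]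
    congr 1
    push_cast
    ring
  · have hc : Continuous (Function.uncurry fun (x : ℝ × ℝ) (y : ℝ) =>
        Complex.exp ((y * (x.2 - x.1) : ℝ) * Complex.I)) := by
      unfold Function.uncurry
      fun_prop
    refine Integrable.of_bound hc.aestronglyMeasurable 1 ?_
    filter_upwards with p
    simp only [Function.uncurry]
    rw [Complex.norm_exp_ofReal_mul_I]

lemma exp_sq_integrable : Integrable (fun t : ℝ => Real.exp (-t^2)) := by
  have := integrable_exp_neg_mul_sq (b := 1) one_pos
  simpa using this

lemma exp_sq_integral : ∫ t : ℝ, Real.exp (-t^2) = Real.sqrt Real.pi := by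
  have := integral_gaussian 1
  simpa using this

lemma pair_norm (w t : ℝ) :
    ‖Complex.exp ((t * w : ℝ) * Complex.I) * (Real.exp (-t^2) : ℂ)‖ = Real.exp (-t^2) := by
  rw [norm_mul, Complex.norm_exp_ofReal_mul_I, one_mul, Complex.norm_real,
    Real.norm_of_nonneg (Real.exp_nonneg _)]

lemma pair_integrable (w : ℝ) :
    Integrable (fun t : ℝ => Complex.exp ((t * w : ℝ) * Complex.I) * (Real.exp (-t^2) : ℂ)) := by
  refine exp_sq_integrable.mono' (by fun_prop) ?_
  filter_upwards with t
  rw [pair_norm]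

lemma tail_le {c : ℝ} (hc : 0 < c) :
    ∫ t in (Set.Ioc (-c) c)ᶜ, Real.exp (-t^2) ≤ Real.sqrt Real.pi * Real.exp (-c^2) := by
  have hI : ∫ t in Set.Ioi (0:ℝ), Real.exp (-t^2) = Real.sqrt Real.pi / 2 := by
    have := integral_gaussian_Ioi 1
    simpa using this
  have h1 : ∫ t in Set.Ioi c, Real.exp (-t^2) ≤ Real.sqrt Real.pi / 2 * Real.exp (-c^2) := by
    have hs : ∫ t in Set.Ioi (0:ℝ), Real.exp (-(t + c)^2) = ∫ t in Set.Ioi c, Real.exp (-t^2) := by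
      have := (measurePreserving_add_right (volume : Measure ℝ) c).setIntegral_preimage_emb
        (measurableEmbedding_addRight c) (fun t : ℝ => Real.exp (-t^2)) (Set.Ioi c)
      rw [← this]
      simp
    rw [← hs, ← hI, ← integral_mul_const]
    refine setIntegral_mono_on ?_ ?_ measurableSet_Ioi ?_
    · exact (exp_sq_integrable.comp_add_right c).integrableOn
    · exact (exp_sq_integrable.mul_const _).integrableOn
    · intro t ht
      rw [← Real.exp_add, Real.exp_le_exp]
      have : 0 < t := ht
      nlinarith [mul_pos this hc]
  have h2 : ∫ t in Set.Iic (-c), Real.exp (-t^2) = ∫ t in Set.Ioi c, Real.exp (-t^2) := by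
    have := integral_comp_neg_Ioi c (fun t : ℝ => Real.exp (-t^2))
    rw [← this]
    simp
  have h3 : (Set.Ioc (-c) c)ᶜ = Set.Iic (-c) ∪ Set.Ioi c := by
    ext t
    simp only [Set.mem_compl_iff, Set.mem_Ioc, Set.mem_union, Set.mem_Iic, Set.mem_Ioi]
    grind
  rw [h3, setIntegral_union _ measurableSet_Ioi exp_sq_integrable.integrableOn
    exp_sq_integrable.integrableOn, h2]
  · linarith
  · rw [Set.disjoint_left]
    intro t ht ht'
    simp only [Set.mem_Iic, Set.mem_Ioi] at ht ht'
    linarith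

lemma abs_eq_norm_ofReal (x : ℝ) : |x| = ‖(x : ℂ)‖ := by simp


lemma sqrt_pi_id : 1 / (2 * Real.pi) * Real.sqrt Real.pi = (2 * Real.sqrt Real.pi)⁻¹ := by
  have h : Real.sqrt Real.pi * Real.sqrt Real.pi = Real.pi := Real.mul_self_sqrt Real.pi_pos.le
  have h0 : 0 < Real.sqrt Real.pi := Real.sqrt_pos.2 Real.pi_pos
  have hp := Real.pi_pos
  rw [div_mul_eq_mul_div, one_mul, inv_eq_one_div, div_eq_div_iff (by positivity) (by positivity)]
  linarith

lemma norm_half_pi : ‖((1 / (2 * Real.pi) : ℝ) : ℂ)‖ = 1 / (2 * Real.pi) := by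
  rw [Complex.norm_real, Real.norm_of_nonneg (by positivity)]

lemma pairA_abs (u v : ℝ) : |pairA u v| ≤ (2 * Real.sqrt Real.pi)⁻¹ := by
  rw [abs_eq_norm_ofReal, pairA_eq, norm_mul, norm_half_pi, ← sqrt_pi_id, ← exp_sq_integral]
  gcongr
  refine (norm_integral_le_integral_norm _).trans ?_
  simp_rw [pair_norm]
  exact le_rfl

lemma pairB_abs {h : ℝ} (hh : 0 < h) (u v : ℝ) : |pairB h u v| ≤ (2 * Real.sqrt Real.pi)⁻¹ := by
  rw [abs_eq_norm_ofReal, pairB_eq hh, norm_mul, norm_half_pi, ← sqrt_pi_id, ← exp_sq_integral]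
  gcongr
  refine (norm_integral_le_integral_norm _).trans ?_
  simp_rw [pair_norm]
  exact setIntegral_le_integral exp_sq_integrable (ae_of_all _ fun _ => Real.exp_nonneg _)

lemma pair_sub {h : ℝ} (hh : 0 < h) (u v : ℝ) :
    |pairA u v - pairB h u v| ≤ (2 * Real.sqrt Real.pi)⁻¹ * Real.exp (-1/h^2) := by
  have h0 : 0 < h⁻¹ := inv_pos.2 hh
  have hsplit := integral_add_compl (measurableSet_Ioc (a := -h⁻¹) (b := h⁻¹))
    (pair_integrable (u - v))
  have he : ((pairA u v - pairB h u v : ℝ) : ℂ) = (1 / (2 * Real.pi) : ℝ) *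
      ∫ t : ℝ in (Set.Ioc (-h⁻¹) h⁻¹)ᶜ,
        Complex.exp ((t * (u - v) : ℝ) * Complex.I) * Real.exp (-t^2) := by
    rw [Complex.ofReal_sub, pairA_eq, pairB_eq hh, ← hsplit]
    ring
  rw [abs_eq_norm_ofReal, he, norm_mul, norm_half_pi, ← sqrt_pi_id, mul_assoc]
  gcongr
  refine (norm_integral_le_integral_norm _).trans ?_
  simp_rw [pair_norm]
  refine (tail_le h0).trans (le_of_eq ?_)
  congr 2
  field_simp

lemma prod_sub_bound {ι : Type*} (s : Finset ι) (A B : ι → ℝ) {r e : ℝ} (hr : 0 ≤ r)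
    (hA : ∀ i, |A i| ≤ r) (hB : ∀ i, |B i| ≤ r) (hAB : ∀ i, |A i - B i| ≤ r * e) :
    |∏ i ∈ s, A i - ∏ i ∈ s, B i| ≤ s.card * r ^ s.card * e := by
  classical
  induction s using Finset.induction_on with
  | empty => simp
  | insert i s hi ih =>
    rw [Finset.prod_insert hi, Finset.prod_insert hi, Finset.card_insert_of_notMem hi]
    have hP : |∏ i ∈ s, B i| ≤ r ^ s.card := by
      rw [Finset.abs_prod]
      exact (Finset.prod_le_prod (fun _ _ => abs_nonneg _) (fun i _ => hB i)).trans (by simp)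
    have : A i * ∏ i ∈ s, A i - B i * ∏ i ∈ s, B i
      = A i * (∏ i ∈ s, A i - ∏ i ∈ s, B i) + (A i - B i) * ∏ i ∈ s, B i := by ring
    rw [this]
    refine (abs_add_le _ _).trans ?_
    rw [abs_mul, abs_mul]
    have h1 : |A i| * |∏ i ∈ s, A i - ∏ i ∈ s, B i| ≤ r * (s.card * r ^ s.card * e) :=
      mul_le_mul (hA i) ih (abs_nonneg _) hr
    have h2 : |A i - B i| * |∏ i ∈ s, B i| ≤ (r * e) * r ^ s.card :=
      mul_le_mul (hAB i) hP (abs_nonneg _) ((abs_nonneg _).trans (hAB i))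
    refine (add_le_add h1 h2).trans (le_of_eq ?_)
    push_cast
    ring

/-- product Gaussian density centred at `u` -/
noncomputable def gam {d : ℕ} (u x : Fin d → ℝ) : ℝ := ∏ i, gauss (x i - u i)

/-- product scaled sinc kernel -/
noncomputable def Kd {d : ℕ} (h : ℝ) (a b : Fin d → ℝ) : ℝ := ∏ j, kap h (a j - b j)

lemma gam_comp_cont {d : ℕ} {Z : Type*} [TopologicalSpace Z] {f g : Z → Fin d → ℝ}
    (hf : Continuous f) (hg : Continuous g) : Continuous (fun z => gam (f z) (g z)) := by
  unfold gam
  refine continuous_finsetProd _ fun i _ => gauss_cont.comp ?_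
  exact ((continuous_apply i).comp hg).sub ((continuous_apply i).comp hf)

lemma gam_cont_right {d : ℕ} (u : Fin d → ℝ) : Continuous (gam u) :=
  gam_comp_cont continuous_const continuous_id

lemma gam_cont_swap {d : ℕ} :
    Continuous (fun p : (Fin d → ℝ) × (Fin d → ℝ) => gam p.2 p.1) :=
  gam_comp_cont continuous_snd continuous_fst

lemma gam_nonneg {d : ℕ} (u x : Fin d → ℝ) : 0 ≤ gam u x :=
  Finset.prod_nonneg fun _ _ => gauss_nonneg _

lemma gam_le_one {d : ℕ} (u x : Fin d → ℝ) : gam u x ≤ 1 :=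
  Finset.prod_le_one (fun _ _ => gauss_nonneg _) fun _ _ => gauss_le_one _

lemma gam_abs_le_one {d : ℕ} (u x : Fin d → ℝ) : |gam u x| ≤ 1 := by
  rw [abs_of_nonneg (gam_nonneg u x)]; exact gam_le_one u x

lemma gam_integrable {d : ℕ} (u : Fin d → ℝ) : Integrable (gam u) := by
  unfold gam
  exact Integrable.fintype_prod (f := fun i (x : ℝ) => gauss (x - u i))
    fun i => gauss_integrable (u i)

lemma gam_integral {d : ℕ} (u : Fin d → ℝ) : ∫ x, gam u x = 1 := by
  unfold gam
  rw [integral_fintype_prod_volume_eq_prod (fun i (x : ℝ) => gauss (x - u i))]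
  simp [gauss_integral]

lemma Kd_comp_cont {d : ℕ} (h : ℝ) {Z : Type*} [TopologicalSpace Z] {f g : Z → Fin d → ℝ}
    (hf : Continuous f) (hg : Continuous g) : Continuous (fun z => Kd h (f z) (g z)) := by
  unfold Kd
  refine continuous_finsetProd _ fun i _ => (kap_cont h).comp ?_
  exact ((continuous_apply i).comp hf).sub ((continuous_apply i).comp hg)

lemma Kd_cont {d : ℕ} (h : ℝ) :
    Continuous (fun p : (Fin d → ℝ) × (Fin d → ℝ) => Kd h p.1 p.2) :=
  Kd_comp_cont h continuous_fst continuous_snd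

lemma Kd_cont_swap {d : ℕ} (h : ℝ) :
    Continuous (fun p : (Fin d → ℝ) × (Fin d → ℝ) => Kd h p.2 p.1) :=
  Kd_comp_cont h continuous_snd continuous_fst

lemma Kd_cont_right {d : ℕ} (h : ℝ) (a : Fin d → ℝ) : Continuous (Kd h a) :=
  Kd_comp_cont h continuous_const continuous_id

lemma Kd_abs_le {d : ℕ} {h : ℝ} (hh : 0 < h) (a b : Fin d → ℝ) :
    |Kd h a b| ≤ (h⁻¹ * (1 / Real.pi)) ^ d := by
  unfold Kd
  rw [Finset.abs_prod]
  exact (Finset.prod_le_prod (fun _ _ => abs_nonneg _) (fun i _ => kap_abs_le hh _)).trans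
    (by simp)

lemma Kd_self {d : ℕ} (h : ℝ) (a : Fin d → ℝ) : Kd h a a = (h⁻¹ * (1 / Real.pi)) ^ d := by
  simp [Kd, kap_zero]

lemma Kd_memLp {d : ℕ} {h : ℝ} (hh : 0 < h) (a : Fin d → ℝ) : MemLp (Kd h a) 2 := by
  rw [memLp_two_iff_integrable_sq (Kd_cont_right h a).aestronglyMeasurable]
  unfold Kd
  simp_rw [← Finset.prod_pow]
  exact Integrable.fintype_prod (f := fun i (x : ℝ) => kap h (a i - x) ^ 2)
    fun i => (kap_memLp hh (a i)).integrable_sq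

lemma Kd_repro {d : ℕ} {h : ℝ} (hh : 0 < h) (a b : Fin d → ℝ) :
    ∫ x, Kd h a x * Kd h b x = Kd h a b := by
  unfold Kd
  simp_rw [← Finset.prod_mul_distrib]
  rw [integral_fintype_prod_volume_eq_prod (fun i (x : ℝ) => kap h (a i - x) * kap h (b i - x))]
  simp_rw [kap_repro hh]

section mix
set_option linter.unusedSectionVars false
variable {d : ℕ} (G : Measure (Fin d → ℝ)) [IsProbabilityMeasure G]

lemma mix_eq (x : Fin d → ℝ) : mixDensity d G x = ∫ u, gam u x ∂G := rfl

lemma gam_prod_integrable :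
    Integrable (fun p : (Fin d → ℝ) × (Fin d → ℝ) => gam p.2 p.1) (volume.prod G) := by
  rw [integrable_prod_iff' gam_cont_swap.aestronglyMeasurable]
  constructor
  · filter_upwards with u
    exact gam_integrable u
  · simp_rw [Real.norm_of_nonneg (gam_nonneg _ _), gam_integral]
    exact integrable_const _

lemma mix_nonneg (x : Fin d → ℝ) : 0 ≤ mixDensity d G x :=
  integral_nonneg fun u => gam_nonneg u x

lemma mix_abs_le (x : Fin d → ℝ) : |mixDensity d G x| ≤ 1 := by
  have := norm_integral_le_of_norm_le_const (μ := G) (f := fun u => gam u x) (C := 1)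
    (ae_of_all _ fun u => gam_abs_le_one u x)
  rw [mix_eq, ← Real.norm_eq_abs]
  simpa using this

lemma mix_meas : Measurable (mixDensity d G) := by
  exact (gam_cont_swap.stronglyMeasurable.integral_prod_right' (ν := G)).measurable

lemma mix_integrable : Integrable (mixDensity d G) :=
  (gam_prod_integrable G).integral_prod_left

lemma mix_pair {g : (Fin d → ℝ) → ℝ} {M : ℝ} (hg : Measurable g) (hM : ∀ x, |g x| ≤ M) :
    Integrable (fun u => ∫ x, g x * gam u x) G ∧
    ∫ x, g x * mixDensity d G x = ∫ u, (∫ x, g x * gam u x) ∂G := by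
  have hi : Integrable (fun p : (Fin d → ℝ) × (Fin d → ℝ) => g p.1 * gam p.2 p.1)
      (volume.prod G) :=
    (gam_prod_integrable G).bdd_mul (c := M) (hg.comp measurable_fst).aestronglyMeasurable
      (ae_of_all _ fun p => hM p.1)
  refine ⟨hi.integral_prod_right, ?_⟩
  simp_rw [mix_eq, ← integral_const_mul]
  exact integral_integral_swap (f := fun x u => g x * gam u x) hi

lemma mix_integral : ∫ x, mixDensity d G x = 1 := by
  have := (mix_pair G (g := fun _ => 1) (M := 1) measurable_const (by simp)).2
  simp_rw [one_mul] at this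
  rw [this]; simp [gam_integral]

lemma mix_memLp : MemLp (mixDensity d G) 2 := by
  rw [memLp_two_iff_integrable_sq (mix_meas G).aestronglyMeasurable]
  simp_rw [pow_two]
  exact (mix_integrable G).bdd_mul (c := 1) (mix_meas G).aestronglyMeasurable
    (ae_of_all _ fun x => mix_abs_le G x)

/-- `T(a) = ∫ K(a,b) f(b) db` -/
noncomputable def Tf (h : ℝ) (a : Fin d → ℝ) : ℝ := ∫ b, Kd h a b * mixDensity d G b

lemma Tf_meas (h : ℝ) : Measurable (Tf G h) := by
  unfold Tf
  have hm : Measurable (fun p : (Fin d → ℝ) × (Fin d → ℝ) => Kd h p.1 p.2 * mixDensity d G p.2) :=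
    (Kd_cont h).measurable.mul ((mix_meas G).comp measurable_snd)
  exact (hm.stronglyMeasurable.integral_prod_right' (ν := volume)).measurable

lemma Tf_abs_le {h : ℝ} (hh : 0 < h) (a : Fin d → ℝ) :
    |Tf G h a| ≤ (h⁻¹ * (1 / Real.pi)) ^ d := by
  unfold Tf
  rw [← Real.norm_eq_abs]
  refine (norm_integral_le_of_norm_le
    ((mix_integrable G).const_mul ((h⁻¹ * (1 / Real.pi)) ^ d)) (ae_of_all _ fun b => ?_)).trans ?_
  · rw [norm_mul, Real.norm_of_nonneg (mix_nonneg G b)]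
    exact mul_le_mul_of_nonneg_right (Kd_abs_le hh a b) (mix_nonneg G b)
  · rw [integral_const_mul, mix_integral, mul_one]

lemma gam_pairA (u v : Fin d → ℝ) : ∫ x, gam u x * gam v x = ∏ j, pairA (u j) (v j) := by
  unfold gam
  simp_rw [← Finset.prod_mul_distrib]
  rw [integral_fintype_prod_volume_eq_prod (fun i (x : ℝ) => gauss (x - u i) * gauss (x - v i))]
  rfl

lemma gam_pairB (h : ℝ) (u v : Fin d → ℝ) :
    ∫ b, (∫ a, Kd h a b * gam u a) * gam v b = ∏ j, pairB h (u j) (v j) := by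
  unfold gam Kd
  simp_rw [← Finset.prod_mul_distrib]
  have : ∀ b : Fin d → ℝ, ∫ a : Fin d → ℝ, ∏ i, kap h (a i - b i) * gauss (a i - u i)
      = ∏ i, ∫ x : ℝ, kap h (x - b i) * gauss (x - u i) := fun b =>
    integral_fintype_prod_volume_eq_prod (fun i (x : ℝ) => kap h (x - b i) * gauss (x - u i))
  simp_rw [this, ← Finset.prod_mul_distrib]
  rw [integral_fintype_prod_volume_eq_prod (fun i (y : ℝ) =>
    (∫ x : ℝ, kap h (x - y) * gauss (x - u i)) * gauss (y - v i))]
  rfl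

lemma swap_integrable {h : ℝ} (hh : 0 < h) (u : Fin d → ℝ) :
    Integrable (Function.uncurry fun (a b : Fin d → ℝ) =>
      Kd h a b * mixDensity d G b * gam u a) (volume.prod volume) := by
  have hi : Integrable (fun p : (Fin d → ℝ) × (Fin d → ℝ) =>
      gam u p.1 * mixDensity d G p.2) (volume.prod volume) :=
    (gam_integrable u).mul_prod (mix_integrable G)
  have hK : AEStronglyMeasurable (fun p : (Fin d → ℝ) × (Fin d → ℝ) => Kd h p.1 p.2)
      (volume.prod volume) := (Kd_cont h).aestronglyMeasurable
  have hB : ∀ᵐ p : (Fin d → ℝ) × (Fin d → ℝ) ∂(volume.prod volume),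
      ‖Kd h p.1 p.2‖ ≤ (h⁻¹ * (1 / Real.pi)) ^ d := ae_of_all _ fun p => Kd_abs_le hh p.1 p.2
  have h3 := hi.bdd_mul hK hB
  have h4 : (Function.uncurry fun (a b : Fin d → ℝ) => Kd h a b * mixDensity d G b * gam u a)
      = fun p => Kd h p.1 p.2 * (gam u p.1 * mixDensity d G p.2) := by
    funext p
    simp only [Function.uncurry]
    ring
  rw [h4]
  exact h3

lemma bias_fixed {h : ℝ} (hh : 0 < h) (u : Fin d → ℝ) :
    (∫ x, mixDensity d G x * gam u x) - ∫ a, Tf G h a * gam u a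
      ≤ d * (2 * Real.sqrt Real.pi)⁻¹ ^ d * Real.exp (-1/h^2) := by
  -- first term
  obtain ⟨i1, e1⟩ := mix_pair G (gam_cont_right u).measurable (gam_abs_le_one u)
  have e1' : ∫ x, mixDensity d G x * gam u x = ∫ v, (∫ x, gam u x * gam v x) ∂G := by
    rw [← e1]; simp_rw [mul_comm]
  -- second term
  set g : (Fin d → ℝ) → ℝ := fun b => ∫ a, Kd h a b * gam u a with hg
  have hgm : Measurable g := by
    have hm : Measurable (fun p : (Fin d → ℝ) × (Fin d → ℝ) => Kd h p.2 p.1 * gam u p.2) :=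
      (Kd_cont_swap h).measurable.mul
        ((gam_cont_right u).measurable.comp measurable_snd)
    exact (hm.stronglyMeasurable.integral_prod_right' (ν := volume)).measurable
  have hgb : ∀ b, |g b| ≤ (h⁻¹ * (1 / Real.pi)) ^ d := by
    intro b
    rw [← Real.norm_eq_abs]
    refine (norm_integral_le_of_norm_le
      ((gam_integrable u).const_mul ((h⁻¹ * (1 / Real.pi)) ^ d))
      (ae_of_all _ fun a => ?_)).trans ?_
    · rw [norm_mul, Real.norm_of_nonneg (gam_nonneg u a)]
      exact mul_le_mul_of_nonneg_right (Kd_abs_le hh a b) (gam_nonneg u a)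
    · rw [integral_const_mul, gam_integral, mul_one]
  obtain ⟨i2, e2⟩ := mix_pair G hgm hgb
  have e2' : ∫ a, Tf G h a * gam u a = ∫ v, (∫ x, g x * gam v x) ∂G := by
    rw [← e2]
    unfold Tf
    simp_rw [hg, ← integral_mul_const]
    rw [integral_integral_swap]
    · congr 1; ext b; congr 1; ext a; ring
    · exact swap_integrable G hh u
  rw [e1', e2', ← integral_sub i1 i2]
  have hb : ∀ v, (∫ x, gam u x * gam v x) - ∫ x, g x * gam v x
      ≤ d * (2 * Real.sqrt Real.pi)⁻¹ ^ d * Real.exp (-1/h^2) := by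
    intro v
    rw [gam_pairA, gam_pairB]
    refine (le_abs_self _).trans ?_
    have := prod_sub_bound Finset.univ (fun j => pairA (u j) (v j)) (fun j => pairB h (u j) (v j))
      (r := (2 * Real.sqrt Real.pi)⁻¹) (e := Real.exp (-1/h^2)) (by positivity)
      (fun _ => pairA_abs _ _) (fun _ => pairB_abs hh _ _) (fun _ => pair_sub hh _ _)
    simpa using this
  refine (integral_mono (i1.sub i2) (integrable_const _) hb).trans ?_
  simp

lemma bias_le {h : ℝ} (hh : 0 < h) :
    (∫ x, mixDensity d G x ^ 2) - ∫ a, Tf G h a * mixDensity d G a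
      ≤ d * (2 * Real.sqrt Real.pi)⁻¹ ^ d * Real.exp (-1/h^2) := by
  obtain ⟨i1, e1⟩ := mix_pair G (mix_meas G) (mix_abs_le G)
  obtain ⟨i2, e2⟩ := mix_pair G (Tf_meas G h) (Tf_abs_le G hh)
  have e0 : ∫ x, mixDensity d G x ^ 2 = ∫ x, mixDensity d G x * mixDensity d G x := by
    simp_rw [pow_two]
  rw [e0, e1, e2, ← integral_sub i1 i2]
  refine (integral_mono (i1.sub i2) (integrable_const _) (bias_fixed G hh)).trans ?_
  simp

end mix

section joint
set_option linter.unusedSectionVars false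
variable {d : ℕ} (G : Measure (Fin d → ℝ)) [IsProbabilityMeasure G]

/-- the law with the mixture density -/
noncomputable def mixLaw : Measure (Fin d → ℝ) :=
  volume.withDensity (fun x => ENNReal.ofReal (mixDensity d G x))

instance mixLaw_prob : IsProbabilityMeasure (mixLaw G) := by
  constructor
  unfold mixLaw
  rw [withDensity_apply _ MeasurableSet.univ, Measure.restrict_univ,
    ← ofReal_integral_eq_lintegral_ofReal (mix_integrable G) (ae_of_all _ (mix_nonneg G)),
    mix_integral, ENNReal.ofReal_one]

lemma integral_mixLaw (g : (Fin d → ℝ) → ℝ) :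
    ∫ x, g x ∂(mixLaw G) = ∫ x, g x * mixDensity d G x := by
  unfold mixLaw
  rw [integral_withDensity_eq_integral_toReal_smul (mix_meas G).ennreal_ofReal
    (ae_of_all _ fun _ => ENNReal.ofReal_lt_top)]
  congr 1
  ext x
  rw [ENNReal.toReal_ofReal (mix_nonneg G x), smul_eq_mul, mul_comm]

lemma joint_eq (n : ℕ) :
    jointMeasure d n (mixDensity d G) = Measure.pi (fun _ : Fin n => mixLaw G) := by
  symm
  apply Measure.pi_eq
  intro s hs
  unfold jointMeasure
  rw [withDensity_apply _ (MeasurableSet.univ_pi hs), volume_pi, Measure.restrict_pi_pi]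
  have hp : ∀ X : Fin n → Fin d → ℝ, ∏ i, ENNReal.ofReal (mixDensity d G (X i))
      = ENNReal.ofReal (∏ i, mixDensity d G (X i)) := fun X =>
    (ENNReal.ofReal_prod_of_nonneg fun i _ => mix_nonneg G _).symm
  simp_rw [hp]
  rw [← ofReal_integral_eq_lintegral_ofReal
    (Integrable.fintype_prod (f := fun _ x => mixDensity d G x)
      fun i => (mix_integrable G).integrableOn)
    (ae_of_all _ fun X => Finset.prod_nonneg fun i _ => mix_nonneg G _),
    integral_fintype_prod_eq_prod (fun _ x => mixDensity d G x),
    ENNReal.ofReal_prod_of_nonneg fun i _ => integral_nonneg (mix_nonneg G)]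
  refine Finset.prod_congr rfl fun i _ => ?_
  unfold mixLaw
  rw [withDensity_apply _ (hs i), ofReal_integral_eq_lintegral_ofReal
    (mix_integrable G).integrableOn (ae_of_all _ (mix_nonneg G))]

lemma pi_eval_integral {n : ℕ} (g : (Fin d → ℝ) → ℝ) (hg : Measurable g) (i : Fin n) :
    ∫ X : Fin n → Fin d → ℝ, g (X i) ∂(Measure.pi fun _ : Fin n => mixLaw G)
      = ∫ x, g x ∂(mixLaw G) := by
  have h := measurePreserving_eval (fun _ : Fin n => mixLaw G) i
  conv_rhs => rw [← h.map_eq]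
  rw [integral_map h.measurable.aemeasurable hg.aestronglyMeasurable]

lemma pi_eval_pair {n : ℕ} (S : (Fin d → ℝ) × (Fin d → ℝ) → ℝ) (hS : Measurable S)
    {i k : Fin n} (hik : i ≠ k) :
    ∫ X : Fin n → Fin d → ℝ, S (X i, X k) ∂(Measure.pi fun _ : Fin n => mixLaw G)
      = ∫ p, S p ∂((mixLaw G).prod (mixLaw G)) := by
  have hind := (ProbabilityTheory.iIndepFun_pi (μ := fun _ : Fin n => mixLaw G)
    (X := fun _ x => x) (fun _ => aemeasurable_id)).indepFun hik
  rw [ProbabilityTheory.indepFun_iff_map_prod_eq_prod_map_map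
    (measurable_pi_apply i).aemeasurable (measurable_pi_apply k).aemeasurable] at hind
  have h1 := (measurePreserving_eval (fun _ : Fin n => mixLaw G) i).map_eq
  have h2 := (measurePreserving_eval (fun _ : Fin n => mixLaw G) k).map_eq
  change _ = ((Measure.pi fun _ : Fin n => mixLaw G).map (Function.eval i)).prod
    ((Measure.pi fun _ : Fin n => mixLaw G).map (Function.eval k)) at hind
  rw [h1, h2] at hind
  rw [← hind, integral_map ((measurable_pi_apply i).prodMk (measurable_pi_apply k)).aemeasurable
    hS.aestronglyMeasurable]

lemma sincEst_eq (n : ℕ) {h : ℝ} (X : Fin n → Fin d → ℝ) (x : Fin d → ℝ) :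
    sincEst d n h X x = (1 / (n : ℝ)) * ∑ i, Kd h (X i) x := by
  unfold sincEst Kd kap
  simp_rw [Finset.prod_mul_distrib]
  simp only [Finset.prod_const, Finset.card_univ, Fintype.card_fin]
  rw [← Finset.mul_sum, ← mul_assoc]
  congr 1
  rw [one_div, one_div, mul_inv, inv_pow]

/-- explicit form of the integrated squared error -/
noncomputable def ise (n : ℕ) (h : ℝ) (X : Fin n → Fin d → ℝ) : ℝ :=
  (1 / (n : ℝ)) ^ 2 * (∑ i, ∑ k, Kd h (X i) (X k)) - 2 * (1 / (n : ℝ)) * (∑ i, Tf G h (X i))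
    + ∫ x, mixDensity d G x ^ 2

lemma est_memLp (n : ℕ) {h : ℝ} (hh : 0 < h) (X : Fin n → Fin d → ℝ) :
    MemLp (sincEst d n h X) 2 := by
  have : sincEst d n h X = fun x => (1 / (n : ℝ)) * ∑ i, Kd h (X i) x :=
    funext (sincEst_eq n X)
  rw [this]
  exact (memLp_finsetSum _ fun i _ => Kd_memLp hh (X i)).const_mul _

lemma ise_eq (n : ℕ) {h : ℝ} (hh : 0 < h) (X : Fin n → Fin d → ℝ) :
    ∫ x, (sincEst d n h X x - mixDensity d G x) ^ 2 = ise G n h X := by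
  have hKK : ∀ a b : Fin d → ℝ, Integrable (fun x => Kd h a x * Kd h b x) := fun a b =>
    (Kd_memLp hh a).integrable_mul (Kd_memLp hh b)
  have hKf : ∀ a : Fin d → ℝ, Integrable (fun x => Kd h a x * mixDensity d G x) := fun a =>
    (Kd_memLp hh a).integrable_mul (mix_memLp G)
  have hff : Integrable (fun x => mixDensity d G x ^ 2) := (mix_memLp G).integrable_sq
  have hexp : ∀ x, (sincEst d n h X x - mixDensity d G x) ^ 2
      = (1 / (n : ℝ)) ^ 2 * (∑ i, ∑ k, Kd h (X i) x * Kd h (X k) x)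
        - 2 * (1 / (n : ℝ)) * (∑ i, Kd h (X i) x * mixDensity d G x)
        + mixDensity d G x ^ 2 := by
    intro x
    rw [sincEst_eq, ← Finset.sum_mul_sum, ← Finset.sum_mul]
    ring
  have hI1 : Integrable (fun x => ∑ i, ∑ k, Kd h (X i) x * Kd h (X k) x) :=
    integrable_finsetSum _ fun i _ => integrable_finsetSum _ fun k _ => hKK _ _
  have hI2 : Integrable (fun x => ∑ i, Kd h (X i) x * mixDensity d G x) :=
    integrable_finsetSum _ fun i _ => hKf _
  have hI12 : Integrable (fun x => (1 / (n : ℝ)) ^ 2 * (∑ i, ∑ k, Kd h (X i) x * Kd h (X k) x)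
      - 2 * (1 / (n : ℝ)) * (∑ i, Kd h (X i) x * mixDensity d G x)) :=
    (hI1.const_mul _).sub (hI2.const_mul _)
  simp_rw [hexp]
  rw [integral_add hI12 hff,
    integral_sub (hI1.const_mul _) (hI2.const_mul _), integral_const_mul, integral_const_mul,
    integral_finsetSum _ fun i _ => integrable_finsetSum _ fun k _ => hKK _ _,
    integral_finsetSum _ fun i _ => hKf _]
  simp_rw [integral_finsetSum _ fun k _ => hKK _ _, Kd_repro hh]
  rfl

lemma ise_nonneg (n : ℕ) {h : ℝ} (hh : 0 < h) (X : Fin n → Fin d → ℝ) : 0 ≤ ise G n h X := by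
  rw [← ise_eq G n hh]
  exact integral_nonneg fun x => sq_nonneg _

lemma risk_bound (n : ℕ) (hn : 1 ≤ n) {h : ℝ} (hh : 0 < h) :
    sincRisk d n (mixDensity d G) h ≤ ENNReal.ofReal
      ((h⁻¹ * (1 / Real.pi)) ^ d / n
        + 2 * (d * (2 * Real.sqrt Real.pi)⁻¹ ^ d * Real.exp (-1/h^2))) := by
  set M := (h⁻¹ * (1 / Real.pi)) ^ d with hM
  set D := d * (2 * Real.sqrt Real.pi)⁻¹ ^ d * Real.exp (-1/h^2) with hD
  set P := Measure.pi fun _ : Fin n => mixLaw G with hP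
  set B := ∫ a, Tf G h a * mixDensity d G a with hB
  set c := ∫ x, mixDensity d G x ^ 2 with hc
  have hbias : c - B ≤ D := bias_le G hh
  have hc0 : 0 ≤ c := integral_nonneg fun x => sq_nonneg _
  have hD0 : 0 ≤ D := by positivity
  have hinner : ∀ X : Fin n → Fin d → ℝ,
      ∫⁻ x, ENNReal.ofReal ((sincEst d n h X x - mixDensity d G x)^2)
        = ENNReal.ofReal (ise G n h X) := by
    intro X
    rw [← ise_eq G n hh, ofReal_integral_eq_lintegral_ofReal]
    · exact ((est_memLp n hh X).sub (mix_memLp G)).integrable_sq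
    · exact ae_of_all _ fun x => sq_nonneg _
  have hKi : ∀ i k : Fin n, Integrable (fun X : Fin n → Fin d → ℝ => Kd h (X i) (X k)) P := by
    intro i k
    have hcont : Continuous (fun X : Fin n → Fin d → ℝ => Kd h (X i) (X k)) :=
      Kd_comp_cont h (continuous_apply i) (continuous_apply k)
    exact Integrable.of_bound hcont.measurable.aestronglyMeasurable M
      (ae_of_all _ fun X => Kd_abs_le hh _ _)
  have hTi : ∀ i : Fin n, Integrable (fun X : Fin n → Fin d → ℝ => Tf G h (X i)) P := by
    intro i
    exact Integrable.of_bound ((Tf_meas G h).comp (measurable_pi_apply i)).aestronglyMeasurable M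
      (ae_of_all _ fun X => Tf_abs_le G hh _)
  have hI1 : Integrable (fun X : Fin n → Fin d → ℝ => ∑ i, ∑ k, Kd h (X i) (X k)) P :=
    integrable_finsetSum _ fun i _ => integrable_finsetSum _ fun k _ => hKi i k
  have hI2 : Integrable (fun X : Fin n → Fin d → ℝ => ∑ i, Tf G h (X i)) P :=
    integrable_finsetSum _ fun i _ => hTi i
  have hI : Integrable (ise G n h) P :=
    ((hI1.const_mul _).sub (hI2.const_mul _)).add (integrable_const _)
  have eT : ∀ i : Fin n, ∫ X, Tf G h (X i) ∂P = B := by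
    intro i
    rw [pi_eval_integral G _ (Tf_meas G h), integral_mixLaw]
  have eK : ∀ i k : Fin n, ∫ X : Fin n → Fin d → ℝ, Kd h (X i) (X k) ∂P
      = B + if i = k then M - B else 0 := by
    intro i k
    by_cases hik : i = k
    · subst hik
      simp [Kd_self, hM]
    · rw [if_neg hik, add_zero]
      have hKp : Measurable (fun p : (Fin d → ℝ) × (Fin d → ℝ) => Kd h p.1 p.2) :=
        (Kd_cont h).measurable
      rw [pi_eval_pair G (fun p => Kd h p.1 p.2) hKp hik, integral_prod]
      · simp_rw [integral_mixLaw]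
        rfl
      · exact Integrable.of_bound hKp.aestronglyMeasurable M
          (ae_of_all _ fun p => Kd_abs_le hh _ _)
  have eI : ∫ X, ise G n h X ∂P = M / n + (c - B) - B / n := by
    have hI12 : Integrable (fun X : Fin n → Fin d → ℝ =>
        (1 / (n : ℝ)) ^ 2 * (∑ i, ∑ k, Kd h (X i) (X k))
          - 2 * (1 / (n : ℝ)) * (∑ i, Tf G h (X i))) P :=
      (hI1.const_mul _).sub (hI2.const_mul _)
    unfold ise
    rw [integral_add hI12 (integrable_const _),
      integral_sub (hI1.const_mul _) (hI2.const_mul _), integral_const_mul, integral_const_mul,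
      integral_finsetSum _ fun i _ => integrable_finsetSum _ fun k _ => hKi i k,
      integral_finsetSum _ fun i _ => hTi i]
    simp_rw [integral_finsetSum _ fun k _ => hKi _ k, eT, eK]
    simp [Finset.sum_add_distrib]
    have : (n : ℝ) ≠ 0 := by positivity
    field_simp
    ring
  unfold sincRisk
  simp_rw [hinner]
  rw [joint_eq, ← ofReal_integral_eq_lintegral_ofReal hI (ae_of_all _ (ise_nonneg G n hh)), eI]
  apply ENNReal.ofReal_le_ofReal
  have hn' : (1 : ℝ) ≤ n := by exact_mod_cast hn
  have : -B / n ≤ D := by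
    rw [div_le_iff₀ (by linarith)]
    nlinarith
  rw [neg_div] at this
  linarith

end joint

lemma const_eq (d n : ℕ) {h : ℝ} (hh : 0 < h) :
    (h⁻¹ * (1 / Real.pi)) ^ d / n
        + 2 * (d * (2 * Real.sqrt Real.pi)⁻¹ ^ d * Real.exp (-1/h^2))
    = Real.pi ^ (-(d : ℝ)) / (n * h^d) +
            d * 2 ^ (1 - (d : ℝ)) * Real.pi ^ (-(d : ℝ)/2) * Real.exp (-1/h^2) := by
  have hp := Real.pi_pos
  have h1 : Real.pi ^ (-(d : ℝ)) = (Real.pi ^ d)⁻¹ := by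
    rw [Real.rpow_neg hp.le, Real.rpow_natCast]
  have h2 : (2:ℝ) ^ (1 - (d : ℝ)) = 2 * (2 ^ d)⁻¹ := by
    rw [Real.rpow_sub two_pos, Real.rpow_one, Real.rpow_natCast, div_eq_mul_inv]
  have h3 : Real.pi ^ (-(d : ℝ)/2) = (Real.sqrt Real.pi ^ d)⁻¹ := by
    rw [neg_div, Real.rpow_neg hp.le, Real.sqrt_eq_rpow, ← Real.rpow_natCast, ← Real.rpow_mul hp.le]
    congr 2
    ring
  rw [h1, h2, h3]
  congr 1
  · rw [mul_pow, one_div, inv_pow, inv_pow, div_eq_mul_inv, div_eq_mul_inv, mul_inv]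
    ring
  · rw [inv_pow, mul_pow, mul_inv]
    ring

theorem stmt4 (d : ℕ) (hd : 1 ≤ d) :
    (∀ n : ℕ, 2 ≤ n → ∀ f ∈ gaussMixtures d, ∀ h : ℝ, 0 < h →
      sincRisk d n f h ≤
        ENNReal.ofReal
          (Real.pi ^ (-(d : ℝ)) / (n * h^d) +
            d * 2 ^ (1 - (d : ℝ)) * Real.pi ^ (-(d : ℝ)/2) * Real.exp (-1/h^2))) ∧
    (∃ C : ℝ, 0 < C ∧ ∀ n : ℕ, 2 ≤ n →
      (⨆ f ∈ gaussMixtures d, sincRisk d n f ((Real.log n) ^ (-(1 : ℝ)/2)))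
        ≤ ENNReal.ofReal (C * (Real.log n) ^ ((d : ℝ)/2) / n)) := by
  have part1 : ∀ n : ℕ, 2 ≤ n → ∀ f ∈ gaussMixtures d, ∀ h : ℝ, 0 < h →
      sincRisk d n f h ≤
        ENNReal.ofReal
          (Real.pi ^ (-(d : ℝ)) / (n * h^d) +
            d * 2 ^ (1 - (d : ℝ)) * Real.pi ^ (-(d : ℝ)/2) * Real.exp (-1/h^2)) := by
    rintro n hn f ⟨G, hG, rfl⟩ h hh
    rw [← const_eq d n hh]
    exact risk_bound G n (by omega) hh
  refine ⟨part1, ?_⟩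
  set A : ℝ := Real.pi ^ (-(d : ℝ)) with hA
  set E : ℝ := d * 2 ^ (1 - (d : ℝ)) * Real.pi ^ (-(d : ℝ)/2) with hE
  have hA0 : 0 < A := Real.rpow_pos_of_pos Real.pi_pos _
  have hE0 : 0 ≤ E := by positivity
  set L : ℝ := Real.log 2 ^ ((d : ℝ)/2) with hL
  have hl2 : 0 < Real.log 2 := Real.log_pos one_lt_two
  have hL0 : 0 < L := Real.rpow_pos_of_pos hl2 _
  refine ⟨A + E / L, by positivity, fun n hn => ?_⟩
  refine iSup₂_le fun f hf => ?_
  have hn2 : (2 : ℝ) ≤ n := by exact_mod_cast hn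
  have hln : Real.log 2 ≤ Real.log n := Real.log_le_log two_pos hn2
  have hl0 : 0 < Real.log n := hl2.trans_le hln
  have hh : 0 < Real.log n ^ (-(1 : ℝ)/2) := Real.rpow_pos_of_pos hl0 _
  refine (part1 n hn f hf _ hh).trans (ENNReal.ofReal_le_ofReal ?_)
  have e1 : (Real.log n ^ (-(1 : ℝ)/2)) ^ d = (Real.log n ^ ((d : ℝ)/2))⁻¹ := by
    rw [← Real.rpow_natCast, ← Real.rpow_mul hl0.le, ← Real.rpow_neg hl0.le]
    congr 1
    ring
  have e2 : (Real.log n ^ (-(1 : ℝ)/2)) ^ 2 = (Real.log n)⁻¹ := by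
    rw [← Real.rpow_natCast, ← Real.rpow_mul hl0.le, ← Real.rpow_neg_one]
    congr 1
    norm_num
  have e3 : Real.exp (-1 / (Real.log n)⁻¹) = (n : ℝ)⁻¹ := by
    rw [div_inv_eq_mul, neg_one_mul, Real.exp_neg, Real.exp_log (by linarith)]
  have hmono : L ≤ Real.log n ^ ((d : ℝ)/2) := Real.rpow_le_rpow hl2.le hln (by positivity)
  rw [e1, e2, e3]
  set Q := Real.log n ^ ((d : ℝ)/2) with hQ
  have hQ0 : 0 < Q := hL0.trans_le hmono
  have hn0 : (0 : ℝ) < n := by linarith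
  have k1 : A / (n * Q⁻¹) = A * Q / n := by field_simp
  have k2 : E * (n : ℝ)⁻¹ ≤ E / L * Q / n := by
    rw [← div_eq_mul_inv]
    gcongr
    rw [div_mul_eq_mul_div, le_div_iff₀ hL0]
    gcongr
  rw [k1]
  calc A * Q / n + E * (n : ℝ)⁻¹ ≤ A * Q / n + E / L * Q / n := by gcongr
    _ = (A + E / L) * Q / n := by ring
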